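/- Let 1 ≤ θ < ∞, 1 ≤ ν ≤ p < ∞, 1 ≤ r < p, 1/r − 1/p < α < 1, β = α − 1/r + 1/p. Then for any f on ℝⁿ (n ≥ 2) with finite mixed-norm Besov norm ‖f‖_{L^{p,ν}[L^r]} + (∫₀^∞ [h^{-α}‖Δ₁(h)f‖_{L^{p,ν}[L^r]}]^θ dh/h)^{1/θ}, one has ∫₀^∞ h^{-θβ} ‖Δ₁(h)f‖_{L^{p,ν}(ℝⁿ)}^θ dh/h ≤ c ∫₀^∞ h^{-θα} ‖Δ₁(h)f‖_{L^{p,ν}[L^r]}^θ dh/h. -/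

import Mathlib

open MeasureTheory ENNReal Set
noncomputable section

/-- Nonincreasing rearrangement of an ℝ≥0∞-valued function. -/
def rearr {α : Type*} [MeasurableSpace α] (μ : Measure α) (f : α → ℝ≥0∞) (t : ℝ) : ℝ≥0∞ :=
  sInf {y : ℝ≥0∞ | μ {x | y < f x} ≤ ENNReal.ofReal t}

/-- Lorentz L^{p,ν} functional: (∫₀^∞ (t^{1/p} f*(t))^ν dt/t)^{1/ν}. -/
def lorentz {α : Type*} [MeasurableSpace α] (μ : Measure α) (f : α → ℝ≥0∞)
    (p ν : ℝ) : ℝ≥0∞ :=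
  (∫⁻ t in Set.Ioi (0:ℝ),
    (ENNReal.ofReal (t ^ (1/p)) * rearr μ f t) ^ ν / ENNReal.ofReal t) ^ (1/ν)

/-- Δ₁(h)f(x,y) = f(x+h,y) − f(x,y). -/
def Delta1 {n : ℕ} (h : ℝ) (f : ℝ × (Fin n → ℝ) → ℝ) : ℝ × (Fin n → ℝ) → ℝ :=
  fun z => f (z.1 + h, z.2) - f z

/-- Mixed norm L^{p,ν}[L^r]: first the L^r(ℝ) norm in x, then the Lorentz
L^{p,ν}(ℝ^{n-1}) norm in y. -/
def mixedLorLr {n : ℕ} (p ν r : ℝ) (f : ℝ × (Fin n → ℝ) → ℝ) : ℝ≥0∞ :=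
  lorentz volume
    (fun y : Fin n → ℝ => (∫⁻ x : ℝ, (‖f (x, y)‖₊ : ℝ≥0∞) ^ r) ^ (1/r)) p ν

theorem lintegral_Ioi_comp_mul_left {a : ℝ} (ha : 0 < a) (F : ℝ → ℝ≥0∞) :
    ∫⁻ s in Ioi (0:ℝ), F (a * s) = ENNReal.ofReal a⁻¹ * ∫⁻ s in Ioi (0:ℝ), F s := by
  have e := lintegral_map_equiv (μ := volume) ((Ioi (0:ℝ)).indicator F)
    (MeasurableEquiv.mulLeft₀ a ha.ne')
  rw [MeasurableEquiv.coe_mulLeft₀, Real.map_volume_mul_left ha.ne', lintegral_smul_measure,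
    abs_of_pos (inv_pos.mpr ha), lintegral_indicator measurableSet_Ioi] at e
  rw [← smul_eq_mul, e, ← lintegral_indicator measurableSet_Ioi]
  refine lintegral_congr fun s => ?_
  simp [indicator, mul_pos_iff_of_pos_left ha]

theorem lintegral_Ioi_rpow_mul_comp_mul_left {a : ℝ} (ha : 0 < a) (ν : ℝ) (L : ℝ → ℝ≥0∞) :
    ∫⁻ s in Ioi (0:ℝ), ENNReal.ofReal (s ^ (ν - 1)) * L (a * s) =
      ENNReal.ofReal (a ^ (-ν)) * ∫⁻ s in Ioi (0:ℝ), ENNReal.ofReal (s ^ (ν - 1)) * L s := by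
  have h1 : ∫⁻ s in Ioi (0:ℝ), ENNReal.ofReal (s ^ (ν - 1)) * L (a * s) =
      ∫⁻ s in Ioi (0:ℝ), ENNReal.ofReal (a ^ (1 - ν)) *
        (ENNReal.ofReal ((a * s) ^ (ν - 1)) * L (a * s)) := by
    refine setLIntegral_congr_fun measurableSet_Ioi fun s hs => ?_
    have hs' : (0:ℝ) < s := hs
    rw [← mul_assoc, ← ENNReal.ofReal_mul (by positivity), Real.mul_rpow ha.le hs'.le,
      ← mul_assoc, ← Real.rpow_add ha]
    simp
  rw [h1, lintegral_const_mul' _ _ ENNReal.ofReal_ne_top,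
    lintegral_Ioi_comp_mul_left ha (fun s => ENNReal.ofReal (s ^ (ν - 1)) * L s), ← mul_assoc,
    ← ENNReal.ofReal_mul (by positivity), ← Real.rpow_neg_one, ← Real.rpow_add ha]
  ring_nf

theorem ENNReal.rpow_tsum_le_tsum_rpow {ι : Type*} (a : ι → ℝ≥0∞) {q : ℝ} (hq : 0 < q)
    (hq1 : q ≤ 1) : (∑' k, a k) ^ q ≤ ∑' k, a k ^ q := by
  set B := ∑' k, a k ^ q with hB
  rcases eq_or_ne B ∞ with h | h
  · simp [h]
  have hk : ∀ k, a k ≤ a k ^ q * B ^ ((1 - q) / q) := fun k => by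
    have h1 : a k ≤ B ^ (1 / q) := by
      rw [one_div, ENNReal.le_rpow_inv_iff hq]
      exact ENNReal.le_tsum k
    have h2 : a k ^ (1 - q) ≤ B ^ ((1 - q) / q) := by
      calc a k ^ (1 - q) ≤ (B ^ (1 / q)) ^ (1 - q) :=
            ENNReal.rpow_le_rpow h1 (by linarith)
        _ = _ := by rw [← ENNReal.rpow_mul]; congr 1; ring
    calc a k = a k ^ q * a k ^ (1 - q) := by
          rw [← ENNReal.rpow_add_of_nonneg _ _ hq.le (by linarith)]; simp
      _ ≤ _ := by gcongr
  calc (∑' k, a k) ^ q ≤ (∑' k, a k ^ q * B ^ ((1 - q) / q)) ^ q :=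
        ENNReal.rpow_le_rpow (ENNReal.tsum_le_tsum hk) hq.le
    _ = (B * B ^ ((1 - q) / q)) ^ q := by rw [ENNReal.tsum_mul_right]
    _ = B := by
        nth_rewrite 1 [← ENNReal.rpow_one B]
        rw [← ENNReal.rpow_add_of_nonneg _ _ zero_le_one (div_nonneg (by linarith) hq.le),
          ← ENNReal.rpow_mul]
        have : (1 + (1 - q) / q) * q = 1 := by field_simp; ring
        rw [this, ENNReal.rpow_one]

/-- The functional `∫₀^∞ s^{ν-1} μ{f > s}^{ν/p} ds`, which is `‖f‖_{p,ν}^ν / p`. -/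
def layerInt {α : Type*} [MeasurableSpace α] (μ : Measure α) (f : α → ℝ≥0∞) (p ν : ℝ) : ℝ≥0∞ :=
  ∫⁻ s in Ioi (0:ℝ), ENNReal.ofReal (s ^ (ν - 1)) * μ {x | ENNReal.ofReal s < f x} ^ (ν / p)

theorem lintegral_rpow_sub_one_Ioo {b : ℝ} (hb : 0 ≤ b) {κ : ℝ} (hκ : 0 < κ) :
    ∫⁻ s in Ioo (0:ℝ) b, ENNReal.ofReal (s ^ (κ - 1)) = ENNReal.ofReal (b ^ κ / κ) := by
  have hi : IntervalIntegrable (fun s : ℝ => s ^ (κ - 1)) volume 0 b :=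
    intervalIntegral.intervalIntegrable_rpow' (by linarith)
  rw [setLIntegral_congr Ioo_ae_eq_Ioc, ← ofReal_integral_eq_lintegral_ofReal,
    ← intervalIntegral.integral_of_le hb, integral_rpow (Or.inl (by linarith))]
  · simp [Real.zero_rpow hκ.ne']
  · exact (intervalIntegrable_iff_integrableOn_Ioc_of_le hb).1 hi
  · filter_upwards [ae_restrict_mem measurableSet_Ioc] with s hs
    exact Real.rpow_nonneg hs.1.le _

theorem lintegral_rpow_sub_one_Ioi {κ : ℝ} (hκ : 0 < κ) :
    ∫⁻ s in Ioi (0:ℝ), ENNReal.ofReal (s ^ (κ - 1)) = ∞ := by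
  have hle : ∀ n : ℕ, ENNReal.ofReal ((n:ℝ) ^ κ / κ) ≤
      ∫⁻ s in Ioi (0:ℝ), ENNReal.ofReal (s ^ (κ - 1)) := fun n => by
    rw [← lintegral_rpow_sub_one_Ioo n.cast_nonneg hκ]
    exact lintegral_mono_set Ioo_subset_Ioi_self
  have ht : Filter.Tendsto (fun n : ℕ => ENNReal.ofReal ((n:ℝ) ^ κ / κ)) Filter.atTop
      (nhds ∞) :=
    ENNReal.tendsto_ofReal_atTop.comp
      (((tendsto_rpow_atTop hκ).comp tendsto_natCast_atTop_atTop).atTop_div_const hκ)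
  exact top_le_iff.1 (le_of_tendsto' ht hle)

theorem lintegral_rpow_sub_one_of_sandwich {κ : ℝ} (hκ : 0 < κ) (b : ℝ≥0∞) {S : Set ℝ}
    (h1 : ∀ s > 0, ENNReal.ofReal s < b → s ∈ S) (h2 : ∀ s > 0, s ∈ S → ENNReal.ofReal s ≤ b) :
    ∫⁻ s in Ioi (0:ℝ), S.indicator (fun s => ENNReal.ofReal (s ^ (κ - 1))) s =
      b ^ κ / ENNReal.ofReal κ := by
  rcases eq_or_ne b ∞ with rfl | hb
  · rw [ENNReal.top_rpow_of_pos hκ, ENNReal.top_div_of_ne_top ENNReal.ofReal_ne_top,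
      ← lintegral_rpow_sub_one_Ioi hκ]
    refine setLIntegral_congr_fun measurableSet_Ioi fun s hs => ?_
    exact indicator_of_mem (h1 s hs ENNReal.ofReal_lt_top) _
  · lift b to NNReal using hb
    have hb0 : (0:ℝ) ≤ b := b.2
    have := lintegral_rpow_sub_one_Ioo hb0 hκ
    rw [ENNReal.ofReal_div_of_pos hκ, ← ENNReal.ofReal_rpow_of_nonneg hb0 hκ.le,
      ENNReal.ofReal_coe_nnreal] at this
    rw [← this, ← lintegral_indicator measurableSet_Ioi, ← lintegral_indicator measurableSet_Ioo]
    refine lintegral_congr_ae ?_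
    have hne : ∀ᵐ s : ℝ, s ≠ b := by simp [ae_iff]
    filter_upwards [hne] with s hs
    rcases le_or_gt s 0 with h0 | h0
    · rw [indicator_of_notMem (by simpa using h0), indicator_of_notMem (by simp [h0])]
    rw [indicator_of_mem (show s ∈ Ioi (0:ℝ) from h0)]
    rcases lt_or_gt_of_ne hs with h | h
    · rw [indicator_of_mem (show s ∈ Ioo (0:ℝ) b from ⟨h0, h⟩), indicator_of_mem]
      apply h1 s h0
      rw [← ENNReal.ofReal_coe_nnreal]
      exact (ENNReal.ofReal_lt_ofReal_iff_of_nonneg h0.le).2 h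
    · rw [indicator_of_notMem (show s ∉ Ioo (0:ℝ) b from fun hh => hh.2.not_gt h),
        indicator_of_notMem]
      intro hS
      have := h2 s h0 hS
      rw [← ENNReal.ofReal_coe_nnreal] at this
      exact ((ENNReal.ofReal_le_ofReal_iff hb0).1 this).not_gt h

theorem lorentz_eq_layerInt {α : Type*} [MeasurableSpace α] (μ : Measure α) (f : α → ℝ≥0∞)
    {p ν : ℝ} (hp : 0 < p) (hν : 0 < ν) :
    lorentz μ f p ν = (ENNReal.ofReal p * layerInt μ f p ν) ^ (1 / ν) := by
  set lam : ℝ → ℝ≥0∞ := fun s => μ {x | ENNReal.ofReal s < f x} with hlam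
  have hanti : Antitone lam := fun s t hst =>
    measure_mono fun x (hx : _ < _) => (ENNReal.ofReal_le_ofReal hst).trans_lt hx
  have hmeas : Measurable lam := hanti.measurable
  set K : ℝ → ℝ → ℝ≥0∞ := fun t s =>
    {z : ℝ × ℝ | ENNReal.ofReal z.1 < lam z.2}.indicator
      (fun z => ENNReal.ofReal (z.1 ^ (ν / p - 1)) * ENNReal.ofReal (z.2 ^ (ν - 1))) (t, s)
    with hK
  have hKm : Measurable (Function.uncurry K) := by
    refine Measurable.indicator (by fun_prop) ?_
    exact measurableSet_lt (by fun_prop) (by fun_prop)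
  have hL : ∀ t ∈ Ioi (0:ℝ), (ENNReal.ofReal (t ^ (1 / p)) * rearr μ f t) ^ ν / ENNReal.ofReal t =
      ENNReal.ofReal ν * ∫⁻ s in Ioi (0:ℝ), K t s := by
    intro t ht
    have ht0 : (0:ℝ) < t := ht
    have key := lintegral_rpow_sub_one_of_sandwich hν (rearr μ f t)
      (S := {s | ENNReal.ofReal t < lam s})
      (fun s hs h => by
        by_contra hcon
        have hle : lam s ≤ ENNReal.ofReal t := not_lt.1 hcon
        have hr : rearr μ f t ≤ ENNReal.ofReal s := sInf_le hle
        exact hr.not_gt h)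
      (fun s hs h => by
        refine le_sInf fun y hy => ?_
        by_contra hcon
        refine (lt_of_lt_of_le h (le_trans (measure_mono ?_) hy)).false
        exact fun x (hx : _ < _) => (not_le.1 hcon).trans hx)
    have hKt : ∀ s, K t s = ENNReal.ofReal (t ^ (ν / p - 1)) *
        {s | ENNReal.ofReal t < lam s}.indicator (fun s => ENNReal.ofReal (s ^ (ν - 1))) s := by
      intro s
      simp only [hK, indicator, mem_ofPred_eq]
      split_ifs <;> simp
    simp_rw [hKt]
    rw [lintegral_const_mul' _ _ ENNReal.ofReal_ne_top, key,
      ENNReal.mul_rpow_of_nonneg _ _ hν.le, ENNReal.ofReal_rpow_of_nonneg (by positivity) hν.le,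
      ← Real.rpow_mul ht0.le]
    have e1 : ENNReal.ofReal (t ^ (ν / p - 1)) = ENNReal.ofReal (t ^ (1 / p * ν)) /
        ENNReal.ofReal t := by
      rw [← ENNReal.ofReal_div_of_pos ht0, Real.rpow_sub_one ht0.ne']
      ring_nf
    rw [e1]
    have hν0 : ENNReal.ofReal ν ≠ 0 := by simpa using hν
    calc _ = (ENNReal.ofReal ν * (ENNReal.ofReal ν)⁻¹) *
          (ENNReal.ofReal (t ^ (1 / p * ν)) * rearr μ f t ^ ν / ENNReal.ofReal t) := by
          rw [ENNReal.mul_inv_cancel hν0 ENNReal.ofReal_ne_top, one_mul]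
      _ = _ := by simp only [div_eq_mul_inv]; ring
  have hR : ∀ s ∈ Ioi (0:ℝ), ∫⁻ t in Ioi (0:ℝ), K t s =
      (ENNReal.ofReal (ν / p))⁻¹ * (ENNReal.ofReal (s ^ (ν - 1)) * lam s ^ (ν / p)) := by
    intro s hs
    have key := lintegral_rpow_sub_one_of_sandwich (div_pos hν hp) (lam s)
      (S := {t | ENNReal.ofReal t < lam s}) (fun t _ h => h) (fun t _ h => le_of_lt h)
    have hKs : ∀ t, K t s = ENNReal.ofReal (s ^ (ν - 1)) *
        {t | ENNReal.ofReal t < lam s}.indicator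
          (fun t => ENNReal.ofReal (t ^ (ν / p - 1))) t := by
      intro t
      simp only [hK, indicator, mem_ofPred_eq]
      split_ifs <;> simp [mul_comm]
    simp_rw [hKs]
    rw [lintegral_const_mul' _ _ ENNReal.ofReal_ne_top, key, div_eq_mul_inv]
    ring
  rw [lorentz, setLIntegral_congr_fun measurableSet_Ioi hL,
    lintegral_const_mul' _ _ ENNReal.ofReal_ne_top, lintegral_lintegral_swap hKm.aemeasurable,
    setLIntegral_congr_fun measurableSet_Ioi hR, lintegral_const_mul' _ _ (by simp; positivity),
    ← mul_assoc, ← ENNReal.ofReal_inv_of_pos (by positivity), ← ENNReal.ofReal_mul hν.le]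
  congr 3
  field_simp

theorem rpow_div_le_tsum_indicator {r u : ℝ} (hr : 0 < r) (hu : 0 < u) {φ : ℝ≥0∞}
    (hφ : ENNReal.ofReal u < φ) :
    φ ^ r / ENNReal.ofReal u ^ r ≤ ∑' k : ℕ, ENNReal.ofReal (2 ^ (((k:ℝ) + 1) * r)) *
      {x : ℝ≥0∞ | ENNReal.ofReal (2 ^ (k:ℝ) * u) < x}.indicator 1 φ := by
  rcases eq_or_ne φ ∞ with rfl | hφt
  · refine le_trans le_top ((ENNReal.tsum_const_eq_top_of_ne_zero (α := ℕ)
      one_ne_zero).symm.le.trans (ENNReal.tsum_le_tsum fun k => ?_))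
    rw [indicator_of_mem (show (∞:ℝ≥0∞) ∈ {x : ℝ≥0∞ | ENNReal.ofReal (2 ^ (k:ℝ) * u) < x} from
      ENNReal.ofReal_lt_top)]
    simp only [Pi.one_apply, mul_one]
    rw [← ENNReal.ofReal_one]
    exact ENNReal.ofReal_le_ofReal (Real.one_le_rpow one_le_two (by positivity))
  · have hex : ∃ m : ℕ, φ.toReal ≤ 2 ^ m * u := by
      obtain ⟨m, hm⟩ := pow_unbounded_of_one_lt (φ.toReal / u) one_lt_two
      exact ⟨m, ((div_lt_iff₀ hu).1 hm).le⟩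
    classical
    have hlt : u < φ.toReal := (ENNReal.ofReal_lt_iff_lt_toReal hu.le hφt).1 hφ
    have hm0 : Nat.find hex ≠ 0 := fun h => by
      have := Nat.find_spec hex
      rw [h] at this
      simp only [pow_zero, one_mul] at this
      linarith
    obtain ⟨k, hk⟩ := Nat.exists_eq_succ_of_ne_zero hm0
    have hspec := Nat.find_spec hex
    rw [hk] at hspec
    have hmin : 2 ^ k * u < φ.toReal :=
      not_le.1 (Nat.find_min hex (m := k) (by rw [hk]; exact Nat.lt_succ_self k))
    refine le_trans ?_ (ENNReal.le_tsum k)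
    rw [indicator_of_mem]
    · simp only [Pi.one_apply, mul_one]
      rw [ENNReal.div_le_iff (ENNReal.rpow_pos (by simpa using hu) ENNReal.ofReal_ne_top).ne'
          (by simp [hr.le]),
        ENNReal.ofReal_rpow_of_pos hu, ← ENNReal.ofReal_mul (by positivity),
        Real.rpow_mul (by norm_num), ← Real.mul_rpow (by positivity) hu.le,
        ← ENNReal.ofReal_rpow_of_pos (by positivity)]
      refine ENNReal.rpow_le_rpow ?_ hr.le
      rw [ENNReal.le_ofReal_iff_toReal_le hφt (by positivity)]
      exact_mod_cast hspec
    · change ENNReal.ofReal _ < φ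
      rw [ENNReal.ofReal_lt_iff_lt_toReal (by positivity) hφt, Real.rpow_natCast]
      exact hmin

/-- The constant in `layerInt_prod_le`. -/
def hardyConst (p ν r : ℝ) : ℝ≥0∞ :=
  ∑' k : ℕ, ENNReal.ofReal (2 ^ (((k:ℝ) + 1) * r * (ν / p) - k * ν))

theorem hardyConst_ne_top {p ν r : ℝ} (hν : 0 < ν) (hp : 0 < p) (hrp : r < p) :
    hardyConst p ν r ≠ ∞ := by
  have hlt : r * (ν / p) - ν < 0 := by
    have : r * (ν / p) - ν = (r - p) * ν / p := by field_simp
    rw [this]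
    exact div_neg_of_neg_of_pos (mul_neg_of_neg_of_pos (by linarith) hν) hp
  have hρ : (2:ℝ) ^ (r * (ν / p) - ν) < 1 := Real.rpow_lt_one_of_one_lt_of_neg one_lt_two hlt
  have hterm : ∀ k : ℕ, (2:ℝ) ^ (((k:ℝ) + 1) * r * (ν / p) - k * ν) =
      2 ^ (r * (ν / p)) * (2 ^ (r * (ν / p) - ν)) ^ k := fun k => by
    rw [← Real.rpow_natCast, ← Real.rpow_mul (by norm_num), ← Real.rpow_add (by norm_num)]
    ring_nf
  have hs : Summable fun k : ℕ => (2:ℝ) ^ (((k:ℝ) + 1) * r * (ν / p) - k * ν) := by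
    simp_rw [hterm]
    exact (summable_geometric_of_lt_one (by positivity) hρ).mul_left _
  exact hs.tsum_ofReal_ne_top

theorem distr_prod_le {Y : Type*} [MeasurableSpace Y] {μ : Measure Y} [SFinite μ]
    {r s σ : ℝ} (hr : 0 < r) (hs : 0 < s) (hσ : 0 < σ)
    {g : ℝ × Y → ℝ≥0∞} (hg : Measurable g) {φ : Y → ℝ≥0∞} (hφ : Measurable φ)
    (h1 : ∀ x y, g (x, y) ^ r ≤ ENNReal.ofReal s⁻¹ * φ y ^ r)
    (h2 : ∀ y, ∫⁻ x, g (x, y) ^ r ≤ φ y ^ r) :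
    (volume.prod μ) {z | ENNReal.ofReal σ < g z} ≤ ENNReal.ofReal s *
      ∑' k : ℕ, ENNReal.ofReal (2 ^ (((k:ℝ) + 1) * r)) *
        μ {y | ENNReal.ofReal (2 ^ (k:ℝ) * s ^ (1 / r) * σ) < φ y} := by
  set u := s ^ (1 / r) * σ with hu
  have hu0 : 0 < u := by positivity
  have hur : ENNReal.ofReal u ^ r = ENNReal.ofReal s * ENNReal.ofReal σ ^ r := by
    rw [hu, ENNReal.ofReal_mul (by positivity), ENNReal.mul_rpow_of_nonneg _ _ hr.le,
      ENNReal.ofReal_rpow_of_pos (by positivity), ← Real.rpow_mul hs.le]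
    simp [hr.ne']
  have hss : ENNReal.ofReal s * ENNReal.ofReal s⁻¹ = 1 := by
    rw [← ENNReal.ofReal_mul hs.le, mul_inv_cancel₀ hs.ne', ENNReal.ofReal_one]
  have hsec : ∀ y, volume {x : ℝ | ENNReal.ofReal σ < g (x, y)} ≤ ENNReal.ofReal s *
      ∑' k : ℕ, ENNReal.ofReal (2 ^ (((k:ℝ) + 1) * r)) *
        {y | ENNReal.ofReal (2 ^ (k:ℝ) * u) < φ y}.indicator 1 y := by
    intro y
    rcases le_or_gt (φ y) (ENNReal.ofReal u) with hle | hlt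
    · have : {x : ℝ | ENNReal.ofReal σ < g (x, y)} = ∅ := by
        ext x
        simp only [mem_ofPred_eq, mem_empty_iff_false, iff_false, not_lt]
        rw [← ENNReal.rpow_le_rpow_iff hr]
        calc g (x, y) ^ r ≤ ENNReal.ofReal s⁻¹ * φ y ^ r := h1 x y
          _ ≤ ENNReal.ofReal s⁻¹ * ENNReal.ofReal u ^ r := by gcongr
          _ = (ENNReal.ofReal s * ENNReal.ofReal s⁻¹) * ENNReal.ofReal σ ^ r := by rw [hur]; ring
          _ = _ := by rw [hss, one_mul]
      simp [this]
    · have hσr0 : ENNReal.ofReal σ ^ r ≠ 0 :=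
        (ENNReal.rpow_pos (by simpa using hσ) ENNReal.ofReal_ne_top).ne'
      have hσrt : ENNReal.ofReal σ ^ r ≠ ∞ := by simp [hr.le]
      have hmark : volume {x : ℝ | ENNReal.ofReal σ < g (x, y)} ≤
          φ y ^ r / ENNReal.ofReal σ ^ r := by
        rw [ENNReal.le_div_iff_mul_le (Or.inl hσr0) (Or.inl hσrt), mul_comm]
        calc _ ≤ ENNReal.ofReal σ ^ r *
              volume {x : ℝ | ENNReal.ofReal σ ^ r ≤ g (x, y) ^ r} := by
              gcongr
              rename_i x
              intro hx
              exact ENNReal.rpow_le_rpow (le_of_lt hx) hr.le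
          _ ≤ ∫⁻ x, g (x, y) ^ r := mul_meas_ge_le_lintegral (by fun_prop) _
          _ ≤ _ := h2 y
      refine hmark.trans ?_
      have := rpow_div_le_tsum_indicator hr hu0 hlt
      calc φ y ^ r / ENNReal.ofReal σ ^ r
          = ENNReal.ofReal s * (φ y ^ r / ENNReal.ofReal u ^ r) := by
            rw [hur, div_eq_mul_inv, div_eq_mul_inv, ENNReal.mul_inv (Or.inr hσrt) (Or.inr hσr0),
              ← ENNReal.ofReal_inv_of_pos hs]
            calc _ = (ENNReal.ofReal s * ENNReal.ofReal s⁻¹) *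
                  (φ y ^ r * (ENNReal.ofReal σ ^ r)⁻¹) := by rw [hss, one_mul]
              _ = _ := by ring
        _ ≤ _ := by gcongr; exact this
  have hms : ∀ k : ℕ, MeasurableSet {y | ENNReal.ofReal (2 ^ (k:ℝ) * u) < φ y} := fun k =>
    measurableSet_lt measurable_const hφ
  rw [Measure.prod_apply_symm (measurableSet_lt measurable_const hg)]
  refine (lintegral_mono hsec).trans (le_of_eq ?_)
  rw [lintegral_const_mul' _ _ ENNReal.ofReal_ne_top, lintegral_tsum]
  · congr 1
    refine tsum_congr fun k => ?_
    rw [lintegral_const_mul' _ _ ENNReal.ofReal_ne_top, lintegral_indicator_one (hms k), mul_assoc]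
  · exact fun k => (measurable_const.mul (measurable_one.indicator (hms k))).aemeasurable

theorem measurable_distr {α : Type*} [MeasurableSpace α] (μ : Measure α) (f : α → ℝ≥0∞) :
    Measurable fun s : ℝ => μ {x | ENNReal.ofReal s < f x} := by
  refine Antitone.measurable fun s t hst => measure_mono fun x hx => ?_
  have hx' : ENNReal.ofReal t < f x := hx
  exact (ENNReal.ofReal_le_ofReal hst).trans_lt hx'

/-- A countable bound on distribution functions transfers to `layerInt`. -/
theorem layerInt_le_tsum {α β : Type*} [MeasurableSpace α] [MeasurableSpace β] {μ : Measure α}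
    {μ' : Measure β} {p ν : ℝ} (hp : 0 < p) (hν : 0 < ν) (hνp : ν ≤ p) {F : α → ℝ≥0∞}
    (g : ℕ → β → ℝ≥0∞) (b : ℕ → ℝ≥0∞) (a : ℕ → ℝ) (ha : ∀ k, 0 < a k)
    (h : ∀ σ > 0, μ {x | ENNReal.ofReal σ < F x} ≤
      ∑' k, b k * μ' {x | ENNReal.ofReal (a k * σ) < g k x}) :
    layerInt μ F p ν ≤
      ∑' k, b k ^ (ν / p) * (ENNReal.ofReal (a k ^ (-ν)) * layerInt μ' (g k) p ν) := by
  have hq : 0 < ν / p := div_pos hν hp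
  have hq1 : ν / p ≤ 1 := (div_le_one hp).2 hνp
  have hm : ∀ k, Measurable fun σ : ℝ => ENNReal.ofReal (σ ^ (ν - 1)) *
      μ' {x | ENNReal.ofReal (a k * σ) < g k x} ^ (ν / p) := fun k => by
    have := (measurable_distr μ' (g k)).comp (measurable_const_mul (a k))
    have h2 := this.pow_const (ν / p)
    exact Measurable.mul (by fun_prop) h2
  calc layerInt μ F p ν
      ≤ ∫⁻ σ in Ioi (0:ℝ), ∑' k, b k ^ (ν / p) * (ENNReal.ofReal (σ ^ (ν - 1)) *
          μ' {x | ENNReal.ofReal (a k * σ) < g k x} ^ (ν / p)) := by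
        refine setLIntegral_mono' measurableSet_Ioi fun σ hσ => ?_
        calc _ ≤ ENNReal.ofReal (σ ^ (ν - 1)) *
              (∑' k, b k * μ' {x | ENNReal.ofReal (a k * σ) < g k x}) ^ (ν / p) := by
              gcongr
              exact h σ hσ
          _ ≤ ENNReal.ofReal (σ ^ (ν - 1)) *
              ∑' k, (b k * μ' {x | ENNReal.ofReal (a k * σ) < g k x}) ^ (ν / p) := by
              gcongr
              exact ENNReal.rpow_tsum_le_tsum_rpow _ hq hq1
          _ = _ := by
              rw [← ENNReal.tsum_mul_left]
              refine tsum_congr fun k => ?_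
              rw [ENNReal.mul_rpow_of_nonneg _ _ hq.le]
              ring
    _ = _ := by
        rw [lintegral_tsum fun k => ((hm k).const_mul _).aemeasurable]
        refine tsum_congr fun k => ?_
        rw [lintegral_const_mul _ (hm k), layerInt, lintegral_Ioi_rpow_mul_comp_mul_left (ha k) ν
          (fun σ => μ' {x | ENNReal.ofReal σ < g k x} ^ (ν / p))]

theorem layerInt_prod_le {Y : Type*} [MeasurableSpace Y] {μ : Measure Y} [SFinite μ]
    {p ν r s : ℝ} (hν : 0 < ν) (hνp : ν ≤ p) (hr : 0 < r) (hs : 0 < s)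
    {g : ℝ × Y → ℝ≥0∞} (hg : Measurable g) {φ : Y → ℝ≥0∞} (hφ : Measurable φ)
    (h1 : ∀ x y, g (x, y) ^ r ≤ ENNReal.ofReal s⁻¹ * φ y ^ r)
    (h2 : ∀ y, ∫⁻ x, g (x, y) ^ r ≤ φ y ^ r) :
    layerInt (volume.prod μ) g p ν ≤
      hardyConst p ν r * (ENNReal.ofReal (s ^ (1 / p - 1 / r)) ^ ν * layerInt μ φ p ν) := by
  have hp : 0 < p := hν.trans_le hνp
  have hq : 0 < ν / p := div_pos hν hp
  refine (layerInt_le_tsum (μ' := μ) hp hν hνp (fun _ => φ)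
    (fun k => ENNReal.ofReal s * ENNReal.ofReal (2 ^ (((k:ℝ) + 1) * r)))
    (fun k => 2 ^ (k:ℝ) * s ^ (1 / r)) (fun k => by positivity) (fun σ hσ => ?_)).trans
    (le_of_eq ?_)
  · refine (distr_prod_le hr hs hσ hg hφ h1 h2).trans (le_of_eq ?_)
    rw [← ENNReal.tsum_mul_left]
    exact tsum_congr fun k => by ring
  · rw [hardyConst, ← ENNReal.tsum_mul_right]
    refine tsum_congr fun k => ?_
    rw [← mul_assoc, ← mul_assoc, ← ENNReal.ofReal_mul hs.le,
      ENNReal.ofReal_rpow_of_pos (by positivity), ENNReal.ofReal_rpow_of_pos (by positivity),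
      ← ENNReal.ofReal_mul (by positivity), ← ENNReal.ofReal_mul (by positivity)]
    congr 2
    rw [Real.mul_rpow hs.le (by positivity), Real.mul_rpow (by positivity) (by positivity),
      ← Real.rpow_mul (by norm_num), ← Real.rpow_mul (by norm_num), ← Real.rpow_mul hs.le,
      ← Real.rpow_mul hs.le]
    calc _ = ((2:ℝ) ^ (((k:ℝ) + 1) * r * (ν / p)) * 2 ^ ((k:ℝ) * -ν)) *
          (s ^ (ν / p) * s ^ (1 / r * -ν)) := by ring
      _ = _ := by
          rw [← Real.rpow_add (by norm_num), ← Real.rpow_add hs]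
          ring_nf

theorem ae_lt_top_of_layerInt_ne_top {α : Type*} [MeasurableSpace α] {μ : Measure α}
    {f : α → ℝ≥0∞} {p ν : ℝ} (hp : 0 < p) (hν : 0 < ν) (h : layerInt μ f p ν ≠ ∞) :
    ∀ᵐ x ∂μ, f x < ∞ := by
  by_contra hcon
  refine h (top_le_iff.1 ?_)
  have hm : μ {x | ¬ f x < ∞} ≠ 0 := hcon
  have hm' : μ {x | ¬ f x < ∞} ^ (ν / p) ≠ 0 :=
    (ENNReal.rpow_pos_of_nonneg (pos_iff_ne_zero.2 hm) (div_pos hν hp).le).ne'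
  calc ∞ = (∫⁻ s in Ioi (0:ℝ), ENNReal.ofReal (s ^ (ν - 1))) *
        μ {x | ¬ f x < ∞} ^ (ν / p) := by
        rw [lintegral_rpow_sub_one_Ioi hν, ENNReal.top_mul hm']
    _ = ∫⁻ s in Ioi (0:ℝ), ENNReal.ofReal (s ^ (ν - 1)) * μ {x | ¬ f x < ∞} ^ (ν / p) := by
        rw [lintegral_mul_const _ (by fun_prop)]
    _ ≤ layerInt μ f p ν := by
        refine lintegral_mono fun s => ?_
        gcongr
        rename_i x
        intro hx
        exact ENNReal.ofReal_lt_top.trans_le (not_lt.1 hx)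

/-- The average of `F` over the interval `(x, x + s]`. -/
def shiftAvg (s : ℝ) (F : ℝ → ℝ≥0∞) (x : ℝ) : ℝ≥0∞ :=
  ENNReal.ofReal s⁻¹ * ∫⁻ u in Ioc (0:ℝ) s, F (x + u)

theorem shiftAvg_rpow_le {r s : ℝ} (hr : 1 ≤ r) (hs : 0 < s) {F : ℝ → ℝ≥0∞} (hF : Measurable F)
    (x : ℝ) : shiftAvg s F x ^ r ≤ shiftAvg s (fun u => F u ^ r) x := by
  have hr0 : 0 < r := by linarith
  set m : Measure ℝ := ENNReal.ofReal s⁻¹ • volume.restrict (Ioc (0:ℝ) s) with hm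
  have hprob : IsProbabilityMeasure m := ⟨by
    simp only [hm, Measure.smul_apply, Measure.restrict_apply_univ, Real.volume_Ioc, sub_zero,
      smul_eq_mul]
    rw [← ENNReal.ofReal_mul (by positivity), inv_mul_cancel₀ hs.ne', ENNReal.ofReal_one]⟩
  have hFx : Measurable fun u => F (x + u) := by fun_prop
  have key := eLpNorm'_le_eLpNorm'_of_exponent_le zero_lt_one hr m hFx.aestronglyMeasurable
  simp only [eLpNorm', enorm_eq_self, ENNReal.rpow_one, div_one] at key
  rw [one_div, ENNReal.le_rpow_inv_iff hr0, hm, lintegral_smul_measure,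
    lintegral_smul_measure] at key
  exact key

theorem shiftAvg_le (s : ℝ) (F : ℝ → ℝ≥0∞) (x : ℝ) :
    shiftAvg s F x ≤ ENNReal.ofReal s⁻¹ * ∫⁻ u, F u := by
  refine mul_le_mul' le_rfl ?_
  exact (setLIntegral_le_lintegral _ _).trans (lintegral_add_left_eq_self (μ := volume) F x).le

theorem lintegral_shiftAvg {s : ℝ} (hs : 0 < s) {F : ℝ → ℝ≥0∞} (hF : Measurable F) :
    ∫⁻ x, shiftAvg s F x = ∫⁻ u, F u := by
  unfold shiftAvg
  rw [lintegral_const_mul' _ _ ENNReal.ofReal_ne_top, lintegral_lintegral_swap (by fun_prop)]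
  simp_rw [lintegral_add_right_eq_self F]
  simp only [lintegral_const, Measure.restrict_apply_univ, Real.volume_Ioc, sub_zero]
  rw [mul_comm, mul_assoc, ← ENNReal.ofReal_mul hs.le, mul_inv_cancel₀ hs.ne', ENNReal.ofReal_one,
    mul_one]

theorem enorm_inv_mul_intervalIntegral_le {s : ℝ} (hs : 0 < s) (g : ℝ → ℝ) (x : ℝ) :
    ‖s⁻¹ * ∫ u in (0:ℝ)..s, g (x + u)‖ₑ ≤ shiftAvg s (fun u => ‖g u‖ₑ) x := by
  rw [enorm_mul, intervalIntegral.integral_of_le hs.le, Real.enorm_of_nonneg (by positivity)]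
  unfold shiftAvg
  gcongr
  exact enorm_integral_le_lintegral_enorm _

theorem enorm_sub_le_tsum_shiftAvg {f : ℝ → ℝ} (hf : LocallyIntegrable f) {h : ℝ} (hh : 0 < h) :
    ∀ᵐ x, ‖f (x + h) - f x‖ₑ ≤
      ∑' k : ℕ, (shiftAvg (h / 2 ^ k) (fun u => ‖f (u + h / 2 ^ k) - f u‖ₑ) (x + h) +
        shiftAvg (h / 2 ^ k) (fun u => ‖f (u + h / 2 ^ k) - f u‖ₑ) x) := by
  have hsk : ∀ k : ℕ, 0 < h / 2 ^ k := fun k => by positivity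
  have hint : ∀ a b : ℝ, IntervalIntegrable f volume a b := fun a b =>
    (hf.integrableOn_isCompact isCompact_uIcc).intervalIntegrable
  have hint' : ∀ c a b : ℝ, IntervalIntegrable (fun u => f (c + u)) volume a b := fun c a b => by
    have := (hint (c + a) (c + b)).comp_add_left c
    simpa using this
  set N : ℕ → ℝ → ℝ≥0∞ := fun k =>
    shiftAvg (h / 2 ^ k) (fun u => ‖f (u + h / 2 ^ k) - f u‖ₑ) with hN
  set A : ℝ → ℝ → ℝ := fun s x => s⁻¹ * ∫ u in (0:ℝ)..s, f (x + u) with hA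
  have hdiff : ∀ s > 0, ∀ x, ‖A s (x + s) - A s x‖ₑ ≤
      shiftAvg s (fun u => ‖f (u + s) - f u‖ₑ) x := fun s hs x => by
    have : A s (x + s) - A s x = s⁻¹ * ∫ u in (0:ℝ)..s, (fun v => f (v + s) - f v) (x + u) := by
      simp only [hA]
      rw [intervalIntegral.integral_sub, mul_sub]
      · simp only [add_right_comm]
      · simpa only [add_right_comm] using hint' (x + s) 0 s
      · exact hint' x 0 s
    rw [this]
    exact enorm_inv_mul_intervalIntegral_le hs (fun v => f (v + s) - f v) x
  have hhalf : ∀ s > 0, ∀ x, A (2 * s) x - A s x = 2⁻¹ * (A s (x + s) - A s x) :=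
      fun s hs x => by
    have e : ∫ u in (0:ℝ)..2 * s, f (x + u) =
        (∫ u in (0:ℝ)..s, f (x + u)) + ∫ u in (0:ℝ)..s, f (x + s + u) := by
      rw [← intervalIntegral.integral_add_adjacent_intervals (hint' x 0 s) (hint' x s (2 * s))]
      congr 1
      have := intervalIntegral.integral_comp_add_left (fun u => f (x + u)) s (a := 0) (b := s)
      rw [add_zero, ← two_mul] at this
      rw [← this]
      simp only [add_assoc]
    simp only [hA]
    rw [e]
    field_simp
    ring
  have hstep : ∀ x k, edist (A (h / 2 ^ k) x) (A (h / 2 ^ (k + 1)) x) ≤ N (k + 1) x :=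
      fun x k => by
    have h2 : h / 2 ^ k = 2 * (h / 2 ^ (k + 1)) := by rw [pow_succ]; field_simp
    rw [edist_eq_enorm_sub, h2, hhalf _ (hsk _), enorm_mul]
    refine le_trans ?_ (hdiff _ (hsk (k + 1)) x)
    refine mul_le_of_le_one_left' ?_
    rw [Real.enorm_of_nonneg (by norm_num), ← ENNReal.ofReal_one]
    exact ENNReal.ofReal_le_ofReal (by norm_num)
  have hlim : ∀ᵐ x, Filter.Tendsto (fun k : ℕ => A (h / 2 ^ k) x) Filter.atTop (nhds (f x)) := by
    filter_upwards [LocallyIntegrable.ae_hasDerivAt_integral hf] with x hx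
    have h0 : Filter.Tendsto (fun k : ℕ => h / 2 ^ k) Filter.atTop (nhdsWithin 0 (Ioi 0)) := by
      refine tendsto_nhdsWithin_iff.2 ⟨?_, Filter.Eventually.of_forall hsk⟩
      simpa [div_eq_mul_inv] using
        (tendsto_pow_atTop_nhds_zero_of_lt_one (r := (2:ℝ)⁻¹) (by norm_num)
          (by norm_num)).const_mul h
    refine ((hx x).tendsto_slope_zero_right.comp h0).congr fun k => ?_
    simp only [Function.comp, hA, smul_eq_mul]
    rw [intervalIntegral.integral_same, sub_zero, intervalIntegral.integral_comp_add_left, add_zero]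
  have htel : ∀ᵐ x, edist (A h x) (f x) ≤ ∑' k, N (k + 1) x := by
    filter_upwards [hlim] with x hx
    have := edist_le_tsum_of_edist_le_of_tendsto₀ (fun k => N (k + 1) x) (hstep x) hx
    simpa using this
  have htel' : ∀ᵐ x, edist (A h (x + h)) (f (x + h)) ≤ ∑' k, N (k + 1) (x + h) :=
    (quasiMeasurePreserving_add_right volume h).ae htel
  filter_upwards [htel, htel'] with x h1 h2
  have hN0 : ‖A h (x + h) - A h x‖ₑ ≤ N 0 x := by simpa [hN] using hdiff h hh x
  have tele : ∀ z, ∑' k, N k z = N 0 z + ∑' k, N (k + 1) z := fun z =>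
    tsum_eq_zero_add' ENNReal.summable
  rw [ENNReal.tsum_add, tele, tele]
  calc ‖f (x + h) - f x‖ₑ = edist (f (x + h)) (f x) := (edist_eq_enorm_sub _ _).symm
    _ ≤ edist (f (x + h)) (A h (x + h)) + edist (A h (x + h)) (A h x) + edist (A h x) (f x) :=
      edist_triangle4 _ _ _ _
    _ ≤ ∑' k, N (k + 1) (x + h) + N 0 x + ∑' k, N (k + 1) x := by
      rw [edist_comm (f (x + h)), edist_eq_enorm_sub (A h (x + h)) (A h x)]
      gcongr
    _ ≤ N 0 (x + h) + ∑' k, N (k + 1) (x + h) + (N 0 x + ∑' k, N (k + 1) x) := by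
      rw [add_assoc]
      gcongr
      exact le_add_self

section Differences

variable {n : ℕ}

/-- The `L^r` norm in the first variable of `Δ₁(s)f`, as a function of the second variable. -/
def deltaNorm (r : ℝ) (f : ℝ × (Fin n → ℝ) → ℝ) (s : ℝ) (y : Fin n → ℝ) : ℝ≥0∞ :=
  (∫⁻ x : ℝ, (‖Delta1 s f (x, y)‖₊ : ℝ≥0∞) ^ r) ^ (1 / r)

/-- The average over `(x, x + s]` of `|Δ₁(s)f(·, y)|`. -/
def deltaAvg (f : ℝ × (Fin n → ℝ) → ℝ) (s : ℝ) (z : ℝ × (Fin n → ℝ)) : ℝ≥0∞ :=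
  shiftAvg s (fun u => ‖f (u + s, z.2) - f (u, z.2)‖ₑ) z.1

theorem measurable_deltaNorm_uncurry (r : ℝ) {f : ℝ × (Fin n → ℝ) → ℝ} (hf : Measurable f) :
    Measurable (Function.uncurry (deltaNorm r f)) := by
  unfold deltaNorm Delta1 Function.uncurry
  refine Measurable.pow_const ?_ _
  refine Measurable.lintegral_prod_right'
    (f := fun v : (ℝ × (Fin n → ℝ)) × ℝ =>
      (‖f (v.2 + v.1.1, v.1.2) - f (v.2, v.1.2)‖₊ : ℝ≥0∞) ^ r) ?_
  fun_prop

theorem measurable_deltaNorm (r : ℝ) {f : ℝ × (Fin n → ℝ) → ℝ} (hf : Measurable f) (s : ℝ) :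
    Measurable (deltaNorm r f s) :=
  (measurable_deltaNorm_uncurry r hf).of_uncurry_left

theorem measurable_deltaAvg {f : ℝ × (Fin n → ℝ) → ℝ} (hf : Measurable f) (s : ℝ) :
    Measurable (deltaAvg f s) := by
  unfold deltaAvg shiftAvg
  refine Measurable.const_mul ?_ _
  refine Measurable.lintegral_prod_right'
    (f := fun v : (ℝ × (Fin n → ℝ)) × ℝ =>
      ‖f (v.1.1 + v.2 + s, v.1.2) - f (v.1.1 + v.2, v.1.2)‖ₑ) ?_
  fun_prop

theorem mixedLorLr_rpow {p ν r : ℝ} (hp : 0 < p) (hν : 0 < ν) (f : ℝ × (Fin n → ℝ) → ℝ) (s : ℝ) :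
    mixedLorLr p ν r (Delta1 s f) ^ ν =
      ENNReal.ofReal p * layerInt volume (deltaNorm r f s) p ν := by
  rw [mixedLorLr, lorentz_eq_layerInt _ _ hp hν, one_div ν, ENNReal.rpow_inv_rpow hν.ne']
  rfl

theorem measurable_mixedLorLr {p ν : ℝ} (r : ℝ) (hp : 0 < p) (hν : 0 < ν)
    {f : ℝ × (Fin n → ℝ) → ℝ} (hf : Measurable f) :
    Measurable fun s => mixedLorLr p ν r (Delta1 s f) := by
  have e : (fun s => mixedLorLr p ν r (Delta1 s f)) = fun s =>
      (ENNReal.ofReal p * layerInt volume (deltaNorm r f s) p ν) ^ (1 / ν) := by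
    funext s
    rw [mixedLorLr, lorentz_eq_layerInt _ _ hp hν]
    rfl
  rw [e]
  refine (Measurable.const_mul ?_ _).pow_const _
  have hset : MeasurableSet {w : (ℝ × ℝ) × (Fin n → ℝ) |
      ENNReal.ofReal w.1.2 < deltaNorm r f w.1.1 w.2} := by
    have hproj : Measurable fun w : (ℝ × ℝ) × (Fin n → ℝ) => (w.1.1, w.2) := by fun_prop
    have hd := (measurable_deltaNorm_uncurry r hf).comp hproj
    simp only [Function.comp_def, Function.uncurry_apply_pair] at hd
    exact measurableSet_lt (by fun_prop) hd
  have hm : Measurable fun w : ℝ × ℝ =>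
      volume {y : Fin n → ℝ | ENNReal.ofReal w.2 < deltaNorm r f w.1 y} :=
    measurable_measure_prodMk_left hset
  refine Measurable.lintegral_prod_right' (f := fun w : ℝ × ℝ => ENNReal.ofReal (w.2 ^ (ν - 1)) *
    volume {y : Fin n → ℝ | ENNReal.ofReal w.2 < deltaNorm r f w.1 y} ^ (ν / p)) ?_
  exact Measurable.mul (by fun_prop) (hm.pow_const _)

theorem layerInt_deltaAvg_le {p ν r s : ℝ} (hν : 0 < ν) (hνp : ν ≤ p) (hr : 1 ≤ r) (hs : 0 < s)
    {f : ℝ × (Fin n → ℝ) → ℝ} (hf : Measurable f) :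
    layerInt volume (deltaAvg f s) p ν ≤ hardyConst p ν r *
      (ENNReal.ofReal (s ^ (1 / p - 1 / r)) ^ ν * layerInt volume (deltaNorm r f s) p ν) := by
  have hr0 : 0 < r := by linarith
  have hF : ∀ y, Measurable fun u : ℝ => ‖f (u + s, y) - f (u, y)‖ₑ := fun y => by fun_prop
  have hφ : ∀ y, deltaNorm r f s y ^ r = ∫⁻ u, ‖f (u + s, y) - f (u, y)‖ₑ ^ r := fun y => by
    rw [deltaNorm, one_div, ENNReal.rpow_inv_rpow hr0.ne']
    rfl
  refine layerInt_prod_le hν hνp hr0 hs (measurable_deltaAvg hf s) (measurable_deltaNorm r hf s)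
    (fun x y => ?_) (fun y => ?_)
  · rw [hφ]
    exact (shiftAvg_rpow_le hr hs (hF y) x).trans (shiftAvg_le _ _ _)
  · rw [hφ, ← lintegral_shiftAvg hs ((hF y).pow_const r)]
    exact lintegral_mono fun x => shiftAvg_rpow_le hr hs (hF y) x

theorem ae_locallyIntegrable_of_mixedLorLr_lt_top {p ν r : ℝ} (hp : 0 < p) (hν : 0 < ν)
    (hr : 1 ≤ r) {f : ℝ × (Fin n → ℝ) → ℝ} (hf : Measurable f) (h : mixedLorLr p ν r f < ∞) :
    ∀ᵐ y : Fin n → ℝ, LocallyIntegrable fun x => f (x, y) := by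
  have hr0 : 0 < r := by linarith
  have hl : layerInt volume
      (fun y : Fin n → ℝ => (∫⁻ x : ℝ, (‖f (x, y)‖₊ : ℝ≥0∞) ^ r) ^ (1 / r)) p ν ≠ ∞ := by
    intro htop
    rw [mixedLorLr, lorentz_eq_layerInt _ _ hp hν, htop, ENNReal.mul_top (by simpa using hp),
      ENNReal.top_rpow_of_pos (by positivity)] at h
    exact lt_irrefl _ h
  filter_upwards [ae_lt_top_of_layerInt_ne_top hp hν hl] with y hy
  have hmem : MemLp (fun x => f (x, y)) (ENNReal.ofReal r) volume := by
    refine ⟨(hf.comp measurable_prodMk_right).aestronglyMeasurable, ?_⟩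
    rw [eLpNorm_eq_lintegral_rpow_enorm_toReal (by simpa using hr0) ENNReal.ofReal_ne_top,
      ENNReal.toReal_ofReal hr0.le]
    exact hy
  exact hmem.locallyIntegrable (by rw [← ENNReal.ofReal_one]; exact ENNReal.ofReal_le_ofReal hr)

theorem ae_enorm_Delta1_le_tsum {f : ℝ × (Fin n → ℝ) → ℝ} (hf : Measurable f)
    (hloc : ∀ᵐ y : Fin n → ℝ, LocallyIntegrable fun x => f (x, y)) {h : ℝ} (hh : 0 < h) :
    ∀ᵐ z : ℝ × (Fin n → ℝ), ‖Delta1 h f z‖ₑ ≤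
      ∑' k : ℕ, (deltaAvg f (h / 2 ^ k) (z.1 + h, z.2) + deltaAvg f (h / 2 ^ k) z) := by
  have hm : MeasurableSet {z : ℝ × (Fin n → ℝ) | ‖Delta1 h f z‖ₑ ≤
      ∑' k : ℕ, (deltaAvg f (h / 2 ^ k) (z.1 + h, z.2) + deltaAvg f (h / 2 ^ k) z)} := by
    refine measurableSet_le (by unfold Delta1; fun_prop) (Measurable.tsum fun k => ?_)
    exact ((measurable_deltaAvg hf _).comp (by fun_prop)).add (measurable_deltaAvg hf _)
  refine (Measure.ae_prod_iff_ae_ae hm).2 ((Measure.ae_ae_comm hm).2 ?_)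
  filter_upwards [hloc] with y hy
  exact enorm_sub_le_tsum_shiftAvg hy hh

theorem distr_Delta1_le {f : ℝ × (Fin n → ℝ) → ℝ} (hf : Measurable f)
    (hloc : ∀ᵐ y : Fin n → ℝ, LocallyIntegrable fun x => f (x, y)) {h : ℝ} (hh : 0 < h)
    {ε : ℕ → ℝ} (hε : ∀ k, 0 < ε k) (hsum : ∑' k, ENNReal.ofReal (ε k) ≤ 2⁻¹) (σ : ℝ) :
    volume {z | ENNReal.ofReal σ < (‖Delta1 h f z‖₊ : ℝ≥0∞)} ≤
      ∑' k : ℕ, 2 * volume {z | ENNReal.ofReal (ε k * σ) < deltaAvg f (h / 2 ^ k) z} := by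
  set T : ℝ × (Fin n → ℝ) → ℝ × (Fin n → ℝ) := fun z => (z.1 + h, z.2) with hT
  have hTm : MeasurePreserving T volume volume :=
    (measurePreserving_add_right volume h).prod (MeasurePreserving.id volume)
  set S : ℕ → Set (ℝ × (Fin n → ℝ)) := fun k =>
    {z | ENNReal.ofReal (ε k * σ) < deltaAvg f (h / 2 ^ k) z} with hS
  have hSm : ∀ k, MeasurableSet (S k) := fun k =>
    measurableSet_lt measurable_const (measurable_deltaAvg hf _)
  calc volume {z | ENNReal.ofReal σ < (‖Delta1 h f z‖₊ : ℝ≥0∞)}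
      ≤ volume (⋃ k, (T ⁻¹' S k ∪ S k)) := by
        refine measure_mono_ae ?_
        filter_upwards [ae_enorm_Delta1_le_tsum hf hloc hh] with z hz hlt
        change z ∈ ⋃ k, (T ⁻¹' S k ∪ S k)
        by_contra hcon
        simp only [mem_iUnion, not_exists, mem_union, not_or] at hcon
        have hlt' : ENNReal.ofReal σ < ‖Delta1 h f z‖ₑ := hlt
        refine (hlt'.trans_le hz).not_ge ?_
        calc _ ≤ ∑' k, (ENNReal.ofReal (ε k * σ) + ENNReal.ofReal (ε k * σ)) :=
              ENNReal.tsum_le_tsum fun k =>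
                add_le_add (not_lt.1 (hcon k).1) (not_lt.1 (hcon k).2)
          _ = (2 * ENNReal.ofReal σ) * ∑' k, ENNReal.ofReal (ε k) := by
              rw [← ENNReal.tsum_mul_left]
              refine tsum_congr fun k => ?_
              rw [ENNReal.ofReal_mul (hε k).le]
              ring
          _ ≤ (2 * ENNReal.ofReal σ) * 2⁻¹ := by gcongr
          _ = (2 * 2⁻¹) * ENNReal.ofReal σ := by ring
          _ = ENNReal.ofReal σ := by
              rw [ENNReal.mul_inv_cancel two_ne_zero ENNReal.ofNat_ne_top, one_mul]
    _ ≤ ∑' k, volume (T ⁻¹' S k ∪ S k) := measure_iUnion_le _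
    _ ≤ ∑' k, 2 * volume (S k) := by
        refine ENNReal.tsum_le_tsum fun k => (measure_union_le _ _).trans (le_of_eq ?_)
        rw [hTm.measure_preimage (hSm k).nullMeasurableSet, two_mul]

theorem lorentz_Delta1_rpow_le {p ν r : ℝ} (hν : 0 < ν) (hνp : ν ≤ p) (hr : 1 ≤ r)
    {f : ℝ × (Fin n → ℝ) → ℝ} (hf : Measurable f)
    (hloc : ∀ᵐ y : Fin n → ℝ, LocallyIntegrable fun x => f (x, y)) {h : ℝ} (hh : 0 < h)
    {ε : ℕ → ℝ} (hε : ∀ k, 0 < ε k) (hsum : ∑' k, ENNReal.ofReal (ε k) ≤ 2⁻¹) :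
    lorentz volume (fun z => (‖Delta1 h f z‖₊ : ℝ≥0∞)) p ν ^ ν ≤
      2 ^ (ν / p) * hardyConst p ν r * ∑' k : ℕ,
        (ENNReal.ofReal ((ε k)⁻¹ * (h / 2 ^ k) ^ (1 / p - 1 / r)) *
          mixedLorLr p ν r (Delta1 (h / 2 ^ k) f)) ^ ν := by
  have hp : 0 < p := hν.trans_le hνp
  rw [lorentz_eq_layerInt _ _ hp hν, one_div ν, ENNReal.rpow_inv_rpow hν.ne']
  have h1 := layerInt_le_tsum hp hν hνp (fun k => deltaAvg f (h / 2 ^ k)) (fun _ => 2) ε hε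
    (fun σ _ => distr_Delta1_le hf hloc hh hε hsum σ)
  refine (mul_le_mul' le_rfl h1).trans ?_
  rw [← ENNReal.tsum_mul_left, ← ENNReal.tsum_mul_left]
  refine ENNReal.tsum_le_tsum fun k => ?_
  have hs : 0 < h / 2 ^ k := by positivity
  have h2 := layerInt_deltaAvg_le (p := p) hν hνp hr hs hf
  rw [ENNReal.mul_rpow_of_nonneg _ _ hν.le, mixedLorLr_rpow hp hν,
    ENNReal.ofReal_mul (inv_nonneg.2 (hε k).le), ENNReal.mul_rpow_of_nonneg _ _ hν.le,
    ENNReal.ofReal_rpow_of_pos (inv_pos.2 (hε k)), Real.inv_rpow (hε k).le,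
    ← Real.rpow_neg (hε k).le]
  calc _ ≤ ENNReal.ofReal p * (2 ^ (ν / p) * (ENNReal.ofReal (ε k ^ (-ν)) *
        (hardyConst p ν r * (ENNReal.ofReal ((h / 2 ^ k) ^ (1 / p - 1 / r)) ^ ν *
          layerInt volume (deltaNorm r f (h / 2 ^ k)) p ν)))) := by gcongr
    _ = _ := by ring

end Differences

theorem rpow_le_of_rpow_le_tsum {ν θ : ℝ} (hν : 0 < ν) (hθ : 0 < θ) {L K : ℝ≥0∞}
    {v w : ℕ → ℝ≥0∞} (h : L ^ ν ≤ K * ∑' k, (v k * w k) ^ ν) :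
    L ^ θ ≤ (K * ∑' k, v k ^ ν) ^ (θ / ν) * ∑' k, w k ^ θ := by
  set B := ∑' k, w k ^ θ with hB
  have hw : ∀ k, w k ≤ B ^ θ⁻¹ := fun k => by
    rw [ENNReal.le_rpow_inv_iff hθ]
    exact ENNReal.le_tsum k
  have h1 : L ^ ν ≤ (K * ∑' k, v k ^ ν) * B ^ (ν / θ) := by
    refine h.trans ?_
    rw [mul_assoc, ← ENNReal.tsum_mul_right]
    gcongr with k
    rw [ENNReal.mul_rpow_of_nonneg _ _ hν.le]
    gcongr
    calc w k ^ ν ≤ (B ^ θ⁻¹) ^ ν := ENNReal.rpow_le_rpow (hw k) hν.le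
      _ = _ := by rw [← ENNReal.rpow_mul]; congr 1; ring
  calc L ^ θ = (L ^ ν) ^ (θ / ν) := by rw [← ENNReal.rpow_mul]; congr 1; field_simp
    _ ≤ ((K * ∑' k, v k ^ ν) * B ^ (ν / θ)) ^ (θ / ν) :=
      ENNReal.rpow_le_rpow h1 (by positivity)
    _ = _ := by
      rw [ENNReal.mul_rpow_of_nonneg _ _ (by positivity), ← ENNReal.rpow_mul]
      have : ν / θ * (θ / ν) = 1 := by field_simp
      rw [this, ENNReal.rpow_one]

theorem lintegral_Ioi_comp_div_div (G : ℝ → ℝ≥0∞) (k : ℕ) :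
    ∫⁻ h in Ioi (0:ℝ), G (h / 2 ^ k) / ENNReal.ofReal h =
      ∫⁻ h in Ioi (0:ℝ), G h / ENNReal.ofReal h := by
  have hw : ∀ F : ℝ → ℝ≥0∞, ∫⁻ h in Ioi (0:ℝ), F h / ENNReal.ofReal h =
      ∫⁻ h in Ioi (0:ℝ), ENNReal.ofReal (h ^ ((0:ℝ) - 1)) * F h := fun F =>
    setLIntegral_congr_fun measurableSet_Ioi fun h hh => by
      have hh' : (0:ℝ) < h := hh
      simp only [zero_sub]
      rw [Real.rpow_neg_one, ENNReal.ofReal_inv_of_pos hh', mul_comm, div_eq_mul_inv]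
  rw [hw, hw]
  have := lintegral_Ioi_rpow_mul_comp_mul_left (a := ((2:ℝ) ^ k)⁻¹) (by positivity) 0 G
  simp only [neg_zero, Real.rpow_zero, ENNReal.ofReal_one, one_mul] at this
  rw [← this]
  simp only [div_eq_inv_mul]

theorem tsum_ofReal_mul_pow_rpow_ne_top {a ρ κ : ℝ} (ha : 0 < a) (hρ : 0 < ρ) (hρ1 : ρ < 1)
    (hκ : 0 < κ) : ∑' k : ℕ, ENNReal.ofReal (a * ρ ^ k) ^ κ ≠ ∞ := by
  have hs : Summable fun k : ℕ => (a * ρ ^ k) ^ κ := by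
    have e : ∀ k : ℕ, (a * ρ ^ k) ^ κ = a ^ κ * (ρ ^ κ) ^ k := fun k => by
      rw [Real.mul_rpow ha.le (by positivity), ← Real.rpow_natCast, ← Real.rpow_natCast,
        ← Real.rpow_mul hρ.le, ← Real.rpow_mul hρ.le, mul_comm κ]
    simp_rw [e]
    exact (summable_geometric_of_lt_one (by positivity)
      (Real.rpow_lt_one hρ.le hρ1 hκ)).mul_left _
  have e : ∀ k : ℕ, ENNReal.ofReal (a * ρ ^ k) ^ κ = ENNReal.ofReal ((a * ρ ^ k) ^ κ) := fun k =>
    ENNReal.ofReal_rpow_of_pos (by positivity)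
  simp_rw [e]
  exact hs.tsum_ofReal_ne_top

/-- Proposition 3.3: for 1 ≤ θ < ∞, 1 ≤ ν ≤ p < ∞, 1 ≤ r < p,
1/r − 1/p < α < 1 and β = α − 1/r + 1/p, any f with finite mixed-norm Besov norm
satisfies ∫₀^∞ h^{-θβ}‖Δ₁(h)f‖_{L^{p,ν}}^θ dh/h ≤ c ∫₀^∞ h^{-θα}‖Δ₁(h)f‖_{L^{p,ν}[L^r]}^θ dh/h. -/
theorem mixed_lorentz_besov_embedding (n : ℕ) (hn : 1 ≤ n) (θ ν p r α : ℝ)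
    (hθ : 1 ≤ θ) (hν : 1 ≤ ν) (hνp : ν ≤ p) (hr : 1 ≤ r) (hrp : r < p)
    (hα₁ : 1/r - 1/p < α) (hα₂ : α < 1) :
    ∃ c > 0, ∀ f : ℝ × (Fin n → ℝ) → ℝ, Measurable f →
      mixedLorLr p ν r f +
        (∫⁻ h in Set.Ioi (0:ℝ),
          (ENNReal.ofReal (h ^ (-α)) * mixedLorLr p ν r (Delta1 h f)) ^ θ
            / ENNReal.ofReal h) ^ (1/θ) < ∞ →
      ∫⁻ h in Set.Ioi (0:ℝ),
          (ENNReal.ofReal (h ^ (-(α - 1/r + 1/p))) *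
            lorentz volume (fun z => (‖Delta1 h f z‖₊ : ℝ≥0∞)) p ν) ^ θ
            / ENNReal.ofReal h
        ≤ ENNReal.ofReal c *
          ∫⁻ h in Set.Ioi (0:ℝ),
            (ENNReal.ofReal (h ^ (-α)) * mixedLorLr p ν r (Delta1 h f)) ^ θ
              / ENNReal.ofReal h := by
  have hθ0 : 0 < θ := by linarith
  have hν0 : 0 < ν := by linarith
  have hp : 0 < p := by linarith
  set β := α - 1 / r + 1 / p with hβ
  have hβ0 : 0 < β := by rw [hβ]; linarith
  set ρ : ℝ := 2 ^ (-(β / 4)) with hρ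
  have hρ0 : 0 < ρ := by positivity
  have hρ1 : ρ < 1 := Real.rpow_lt_one_of_one_lt_of_neg one_lt_two (by linarith)
  set ε : ℕ → ℝ := fun k => (1 - ρ) / 2 * ρ ^ k with hε
  have hc0 : 0 < (1 - ρ) / 2 := by linarith
  have hεpos : ∀ k, 0 < ε k := fun k => by positivity
  have hεsum : ∑' k, ENNReal.ofReal (ε k) ≤ 2⁻¹ := by
    have hs : HasSum ε ((1 - ρ) / 2 * (1 - ρ)⁻¹) :=
      (hasSum_geometric_of_lt_one hρ0.le hρ1).mul_left _
    rw [← ENNReal.ofReal_tsum_of_nonneg (fun k => (hεpos k).le) hs.summable, hs.tsum_eq]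
    have h1 : (1 - ρ) / 2 * (1 - ρ)⁻¹ = 2⁻¹ := by
      have : 1 - ρ ≠ 0 := by linarith
      field_simp
    rw [h1, ENNReal.ofReal_inv_of_pos two_pos, ENNReal.ofReal_ofNat]
  set K : ℝ≥0∞ := 2 ^ (ν / p) * hardyConst p ν r with hK
  set V : ℝ≥0∞ := ∑' k : ℕ, ENNReal.ofReal (1 * ρ ^ k) ^ ν with hV
  set W : ℝ≥0∞ := ∑' k : ℕ, ENNReal.ofReal (((1 - ρ) / 2)⁻¹ * (ρ ^ 2) ^ k) ^ θ with hW
  set C : ℝ≥0∞ := (K * V) ^ (θ / ν) * W with hC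
  have hCtop : C ≠ ∞ := by
    refine ENNReal.mul_ne_top (ENNReal.rpow_ne_top_of_nonneg (by positivity)
      (ENNReal.mul_ne_top (ENNReal.mul_ne_top ?_ (hardyConst_ne_top hν0 hp hrp)) ?_)) ?_
    · exact ENNReal.rpow_ne_top_of_nonneg (by positivity) ENNReal.ofNat_ne_top
    · exact tsum_ofReal_mul_pow_rpow_ne_top one_pos hρ0 hρ1 hν0
    · exact tsum_ofReal_mul_pow_rpow_ne_top (inv_pos.2 hc0) (by positivity)
        (pow_lt_one₀ hρ0.le hρ1 two_ne_zero) hθ0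
  refine ⟨C.toReal + 1, by positivity, fun f hf hfin => ?_⟩
  have hloc := ae_locallyIntegrable_of_mixedLorLr_lt_top hp hν0 hr hf
    (lt_of_le_of_lt le_self_add hfin)
  set G : ℝ → ℝ≥0∞ := fun h =>
    (ENNReal.ofReal (h ^ (-α)) * mixedLorLr p ν r (Delta1 h f)) ^ θ with hG
  have hGm : Measurable G := by
    have := measurable_mixedLorLr r hp hν0 hf
    exact (Measurable.mul (by fun_prop) this).pow_const θ
  have hpt : ∀ h ∈ Ioi (0:ℝ), (ENNReal.ofReal (h ^ (-β)) *
      lorentz volume (fun z => (‖Delta1 h f z‖₊ : ℝ≥0∞)) p ν) ^ θ / ENNReal.ofReal h ≤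
      ∑' k : ℕ, (K * V) ^ (θ / ν) * ENNReal.ofReal (((1 - ρ) / 2)⁻¹ * (ρ ^ 2) ^ k) ^ θ *
        (G (h / 2 ^ k) / ENNReal.ofReal h) := by
    intro h hh
    have hh0 : (0:ℝ) < h := hh
    have hL := lorentz_Delta1_rpow_le hν0 hνp hr hf hloc hh0 hεpos hεsum
    have hvw : ∀ k : ℕ, ENNReal.ofReal ((ε k)⁻¹ * (h / 2 ^ k) ^ (1 / p - 1 / r)) *
        mixedLorLr p ν r (Delta1 (h / 2 ^ k) f) =
        ENNReal.ofReal (1 * ρ ^ k) * (ENNReal.ofReal ((ρ ^ k)⁻¹ * (ε k)⁻¹ *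
          (h / 2 ^ k) ^ (1 / p - 1 / r)) * mixedLorLr p ν r (Delta1 (h / 2 ^ k) f)) := by
      intro k
      rw [← mul_assoc, ← ENNReal.ofReal_mul (by positivity)]
      congr 2
      field_simp
    simp_rw [hvw] at hL
    have hLθ := rpow_le_of_rpow_le_tsum hν0 hθ0 hL
    rw [ENNReal.mul_rpow_of_nonneg _ _ hθ0.le]
    calc _ ≤ ENNReal.ofReal (h ^ (-β)) ^ θ * ((K * V) ^ (θ / ν) * ∑' k : ℕ,
          (ENNReal.ofReal ((ρ ^ k)⁻¹ * (ε k)⁻¹ * (h / 2 ^ k) ^ (1 / p - 1 / r)) *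
            mixedLorLr p ν r (Delta1 (h / 2 ^ k) f)) ^ θ) / ENNReal.ofReal h := by gcongr
      _ = _ := by
          rw [div_eq_mul_inv, ← ENNReal.tsum_mul_left, ← ENNReal.tsum_mul_left,
            ← ENNReal.tsum_mul_right]
          refine tsum_congr fun k => ?_
          have hsk : 0 < h / 2 ^ k := by positivity
          have hreal : h ^ (-β) * ((ρ ^ k)⁻¹ * (ε k)⁻¹ * (h / 2 ^ k) ^ (1 / p - 1 / r)) =
              ((1 - ρ) / 2)⁻¹ * (ρ ^ 2) ^ k * (h / 2 ^ k) ^ (-α) := by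
            have e1 : h ^ (-β) = ρ ^ (4 * k) * (h / 2 ^ k) ^ (-β) := by
              have e2 : (2 ^ k : ℝ) ^ (-β) = ρ ^ (4 * k) := by
                rw [hρ, ← Real.rpow_natCast, ← Real.rpow_natCast, ← Real.rpow_mul two_pos.le,
                  ← Real.rpow_mul two_pos.le]
                congr 1
                push_cast
                ring
              rw [← e2, ← Real.mul_rpow (by positivity) hsk.le]
              congr 1
              field_simp
            have e3 : (h / 2 ^ k) ^ (-α) =
                (h / 2 ^ k) ^ (-β) * (h / 2 ^ k) ^ (1 / p - 1 / r) := by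
              rw [← Real.rpow_add hsk, hβ]
              congr 1
              ring
            rw [e1, e3, hε]
            have : ρ ^ (4 * k) * ((ρ ^ k)⁻¹ * ((1 - ρ) / 2 * ρ ^ k)⁻¹) =
                ((1 - ρ) / 2)⁻¹ * (ρ ^ 2) ^ k := by
              rw [mul_inv, ← pow_mul, pow_mul ρ 4 k, pow_mul ρ 2 k]
              have h4 : (ρ ^ 4) ^ k = (ρ ^ k) ^ 4 := by rw [← pow_mul, ← pow_mul, mul_comm]
              have h2 : (ρ ^ 2) ^ k = (ρ ^ k) ^ 2 := by rw [← pow_mul, ← pow_mul, mul_comm]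
              rw [h4, h2]
              have : ρ ^ k ≠ 0 := by positivity
              field_simp
            rw [← this]
            ring
          have hterm : ENNReal.ofReal (h ^ (-β)) ^ θ *
              (ENNReal.ofReal ((ρ ^ k)⁻¹ * (ε k)⁻¹ * (h / 2 ^ k) ^ (1 / p - 1 / r)) *
                mixedLorLr p ν r (Delta1 (h / 2 ^ k) f)) ^ θ =
              ENNReal.ofReal (((1 - ρ) / 2)⁻¹ * (ρ ^ 2) ^ k) ^ θ * G (h / 2 ^ k) := by
            rw [hG, ← ENNReal.mul_rpow_of_nonneg _ _ hθ0.le,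
              ← ENNReal.mul_rpow_of_nonneg _ _ hθ0.le, ← mul_assoc, ← mul_assoc,
              ← ENNReal.ofReal_mul (by positivity), ← ENNReal.ofReal_mul (by positivity), hreal]
          rw [div_eq_mul_inv (G (h / 2 ^ k))]
          calc _ = (K * V) ^ (θ / ν) * (ENNReal.ofReal (h ^ (-β)) ^ θ *
              (ENNReal.ofReal ((ρ ^ k)⁻¹ * (ε k)⁻¹ * (h / 2 ^ k) ^ (1 / p - 1 / r)) *
                mixedLorLr p ν r (Delta1 (h / 2 ^ k) f)) ^ θ) * (ENNReal.ofReal h)⁻¹ := by ring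
            _ = _ := by rw [hterm]; ring
  refine (setLIntegral_mono' measurableSet_Ioi hpt).trans ?_
  have hm : ∀ k : ℕ, Measurable fun h : ℝ => G (h / 2 ^ k) / ENNReal.ofReal h := fun k =>
    (hGm.comp (by fun_prop : Measurable fun h : ℝ => h / 2 ^ k)).div ENNReal.measurable_ofReal
  rw [lintegral_tsum fun k => ((hm k).const_mul _).aemeasurable]
  calc _ = ∑' k : ℕ, (K * V) ^ (θ / ν) * ENNReal.ofReal (((1 - ρ) / 2)⁻¹ * (ρ ^ 2) ^ k) ^ θ *
        ∫⁻ h in Ioi (0:ℝ), G h / ENNReal.ofReal h :=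
        tsum_congr fun k => by rw [lintegral_const_mul _ (hm k), lintegral_Ioi_comp_div_div]
    _ = C * ∫⁻ h in Ioi (0:ℝ), G h / ENNReal.ofReal h := by
        rw [ENNReal.tsum_mul_right, ENNReal.tsum_mul_left]
    _ ≤ _ := by
        gcongr
        exact (ENNReal.le_ofReal_iff_toReal_le hCtop (by positivity)).2 (by linarith)
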